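/- For any two additive codes C₁ and C₂ of type (α,β;γ₁,δ₁;κ₁) and (α,β;γ₂,δ₂;κ₂) respectively, if the code ⟨C₁,C₂⟩ is of type (α,β;γ,δ;κ), then max(κ₁+δ₁, κ₂+δ₂) + max(δ₁,δ₂) ≤ γ+2δ ≤ μ, where μ = min(γ₁+γ₂+2(δ₁+δ₂), γ₁+γ₂+δ₁+δ₂+β, δ₁+δ₂+α+β, α+2β); equivalently, 2^(max(κ₁+δ₁,κ₂+δ₂)+max(δ₁,δ₂)) ≤ |⟨C₁,C₂⟩| ≤ 2^μ. -/

import Mathlib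

open scoped BigOperators

/-- `Z2` is the ring of integers modulo 2. -/
abbrev Z2 : Type := ZMod 2

/-- `Z4` is the ring of integers modulo 4. -/
abbrev Z4 : Type := ZMod 4

/-- The ambient group `Z₂^α × Z₄^β` for additive codes. -/
abbrev Amb (α β : ℕ) : Type := (Fin α → Z2) × (Fin β → Z4)

/-- The inner product on `Z₂^α × Z₄^β`:
`⟨u,v⟩ = 2·(Σᵢ ūᵢ·v̄ᵢ) + Σⱼ uⱼ·vⱼ ∈ Z₄`, where the bar denotes the lift `0 ↦ 0`, `1 ↦ 1`
of binary coordinates into `Z₄`. -/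
def addInner {α β : ℕ} (u v : Amb α β) : Z4 :=
  2 * (∑ i, ((u.1 i).val : Z4) * ((v.1 i).val : Z4)) + ∑ j, u.2 j * v.2 j

lemma addInner_zero_left {α β : ℕ} (v : Amb α β) : addInner 0 v = 0 := by
  simp [addInner]

lemma addInner_add_left {α β : ℕ} (u u' v : Amb α β) :
    addInner (u + u') v = addInner u v + addInner u' v := by
  have key : ∀ x x' y : Z2,
      (2 : Z4) * ((((x + x').val : ℕ) : Z4) * ((y.val : ℕ) : Z4)) =
        2 * (((x.val : ℕ) : Z4) * ((y.val : ℕ) : Z4)) +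
          2 * (((x'.val : ℕ) : Z4) * ((y.val : ℕ) : Z4)) := by decide
  simp only [addInner, Prod.fst_add, Prod.snd_add, Pi.add_apply, add_mul,
    Finset.mul_sum, Finset.sum_add_distrib]
  rw [Finset.sum_congr rfl (fun i _ => key (u.1 i) (u'.1 i) (v.1 i)),
    Finset.sum_add_distrib]
  ring

lemma addInner_neg_left {α β : ℕ} (u v : Amb α β) :
    addInner (-u) v = - addInner u v := by
  have hn : ∀ x : Z2, (-x) = x := by decide
  have key : ∀ S T : Z4, 2 * S + -T = -(2 * S + T) := by decide
  simp only [addInner, Prod.fst_neg, Prod.snd_neg, Pi.neg_apply, hn, neg_mul]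
  rw [Finset.sum_neg_distrib]
  exact key _ _

/-- The additive dual `C^⊥ = {u : ⟨u,v⟩ = 0 for all v ∈ C}` of an additive code `C`. -/
def dualCode {α β : ℕ} (C : AddSubgroup (Amb α β)) : AddSubgroup (Amb α β) where
  carrier := {u | ∀ v ∈ C, addInner u v = 0}
  zero_mem' := fun v _ => addInner_zero_left v
  add_mem' := by
    intro a b ha hb v hv
    rw [addInner_add_left, ha v hv, hb v hv, add_zero]
  neg_mem' := by
    intro a ha v hv
    rw [addInner_neg_left, ha v hv, neg_zero]

/-- An additive code `C ⊆ Z₂^α × Z₄^β` is of type `(α,β;γ,δ)` when it is isomorphic,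
as an abelian group, to `Z₂^γ × Z₄^δ`; equivalently (which is how we state it),
`|C| = 2^(γ+2δ)` and the number of elements `x ∈ C` with `x + x = 0` is `2^(γ+δ)`. -/
def isOfType {α β : ℕ} (C : AddSubgroup (Amb α β)) (γ δ : ℕ) : Prop :=
  Nat.card C = 2 ^ (γ + 2 * δ) ∧
    Nat.card {x : Amb α β // x ∈ C ∧ x + x = 0} = 2 ^ (γ + δ)

/-- An additive code `C` is of type `(α,β;γ,δ;κ)` when it is of type `(α,β;γ,δ)` and
`2^κ` is the cardinality of the image of `{x ∈ C : x + x = 0}` under the projection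
onto the binary coordinates. -/
def isOfTypeK {α β : ℕ} (C : AddSubgroup (Amb α β)) (γ δ κ : ℕ) : Prop :=
  isOfType C γ δ ∧
    Nat.card ↥(Prod.fst '' {x : Amb α β | x ∈ C ∧ x + x = 0}) = 2 ^ κ

/-- The Gray map on one quaternary coordinate:
`0 ↦ (0,0)`, `1 ↦ (0,1)`, `2 ↦ (1,1)`, `3 ↦ (1,0)`. -/
def grayPhi (y : Z4) : Z2 × Z2 :=
  if y = 0 then (0, 0) else if y = 1 then (0, 1) else if y = 2 then (1, 1) else (1, 0)

/-- The Gray map `Φ : Z₂^α × Z₄^β → Z₂^(α+2β)` (with index set `Fin α ⊕ Fin β × Fin 2`),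
acting as the identity on the binary coordinates and as `grayPhi` coordinatewise on the
quaternary coordinates. -/
def grayMap {α β : ℕ} (u : Amb α β) : (Fin α ⊕ Fin β × Fin 2) → Z2 :=
  Sum.elim (fun a => u.1 a)
    (fun b => if b.2 = 0 then (grayPhi (u.2 b.1)).1 else (grayPhi (u.2 b.1)).2)

/-- The minimum Hamming distance of a binary code `S` equals `d`. -/
def minDistEq {ι : Type} [Fintype ι] (S : Set (ι → Z2)) (d : ℕ) : Prop :=
  (∀ x ∈ S, ∀ y ∈ S, x ≠ y → d ≤ hammingDist x y) ∧
    ∃ x ∈ S, ∃ y ∈ S, x ≠ y ∧ hammingDist x y = d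

/-- A quaternary linear perfect code of length `β = 2^(t-1)` (`t ≥ 3`): an additive
subgroup of `Z₄^β` whose Gray image has cardinality `2^(2β-t-1)` and minimum Hamming
distance `4`. -/
def isQuatPerfect (t β : ℕ) (C : AddSubgroup (Amb 0 β)) : Prop :=
  3 ≤ t ∧ β = 2 ^ (t - 1) ∧
    Nat.card ↥(grayMap '' (C : Set (Amb 0 β))) = 2 ^ (2 * β - t - 1) ∧
    minDistEq (grayMap '' (C : Set (Amb 0 β))) 4

/-- An additive extended perfect code with `α ≠ 0` and binary length `α + 2β = 2^t`:
an additive subgroup of `Z₂^α × Z₄^β` with `α ≥ 1` whose Gray image has cardinality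
`2^(2^t - t - 1)` and minimum Hamming distance `4`. -/
def isAddExtPerfect (t α β : ℕ) (C : AddSubgroup (Amb α β)) : Prop :=
  1 ≤ α ∧ α + 2 * β = 2 ^ t ∧
    Nat.card ↥(grayMap '' (C : Set (Amb α β))) = 2 ^ (2 ^ t - t - 1) ∧
    minDistEq (grayMap '' (C : Set (Amb α β))) 4

lemma card_map_mul_card_inf_ker {G H : Type*} [AddGroup G] [AddGroup H]
    (f : G →+ H) (K : AddSubgroup G) :
    Nat.card (K.map f) * Nat.card ↥(f.ker ⊓ K) = Nat.card K := by
  rw [← AddSubgroup.relIndex_ker, ← AddSubgroup.inf_relIndex_right, mul_comm,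
    ← AddSubgroup.relIndex_bot_left, ← AddSubgroup.relIndex_bot_left]
  exact AddSubgroup.relIndex_mul_relIndex _ _ _ bot_le inf_le_right

lemma card_sup_mul_card_inf {G : Type*} [AddCommGroup G] (H K : AddSubgroup G) :
    Nat.card ↥(H ⊔ K) * Nat.card ↥(H ⊓ K) = Nat.card H * Nat.card K := by
  have hK := AddSubgroup.relIndex_mul_relIndex ⊥ K (H ⊔ K) bot_le le_sup_right
  have hH := AddSubgroup.relIndex_mul_relIndex ⊥ (H ⊓ K) H bot_le inf_le_left
  rw [AddSubgroup.relIndex_bot_left, AddSubgroup.relIndex_bot_left,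
    AddSubgroup.relIndex_sup_right] at hK
  rw [AddSubgroup.relIndex_bot_left, AddSubgroup.relIndex_bot_left,
    AddSubgroup.inf_relIndex_left] at hH
  rw [← hK, ← hH]
  ring

/-- Multiplication by two on the ambient group. -/
def doubling (α β : ℕ) : Amb α β →+ Amb α β := nsmulAddMonoidHom 2

@[simp] lemma doubling_apply {α β : ℕ} (x : Amb α β) : doubling α β x = x + x :=
  two_nsmul x

lemma fst_add_self {α β : ℕ} (x : Amb α β) : (x + x).1 = 0 :=
  funext fun i => CharTwo.add_self_eq_zero (x.1 i)

lemma add_self_add_add_self {α β : ℕ} (x : Amb α β) : (x + x) + (x + x) = 0 := by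
  have key : ∀ y : Z4, (y + y) + (y + y) = 0 := by decide
  refine Prod.ext ?_ (funext fun j => key (x.2 j))
  rw [fst_add_self]
  rfl

lemma snd_add_self_of_mem_ker_doubling {α β : ℕ} {x : Amb α β} (hx : x ∈ (doubling α β).ker)
    (j : Fin β) : x.2 j + x.2 j = 0 := by
  rw [AddMonoidHom.mem_ker, doubling_apply] at hx
  exact congrFun (congrArg Prod.snd hx) j

lemma card_fin_fun_two_torsion (β : ℕ) :
    Nat.card (Fin β → {y : Z4 // y + y = 0}) = 2 ^ β := by
  rw [Nat.card_eq_fintype_card, Fintype.card_fun, Fintype.card_fin]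
  congr 1

lemma card_le_of_le_ker_doubling {α β : ℕ} {K : AddSubgroup (Amb α β)}
    (hK : K ≤ (doubling α β).ker) : Nat.card K ≤ 2 ^ (α + β) := by
  let g : K → (Fin α → Z2) × (Fin β → {y : Z4 // y + y = 0}) :=
    fun x => (x.1.1, fun j => ⟨x.1.2 j, snd_add_self_of_mem_ker_doubling (hK x.2) j⟩)
  have hg : Function.Injective g := fun x y hxy =>
    Subtype.ext <| Prod.ext (congrArg Prod.fst hxy :) <| funext fun j =>
      congrArg Subtype.val (congrFun (congrArg Prod.snd hxy :) j)
  refine (Nat.card_le_card_of_injective g hg).trans_eq ?_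
  rw [Nat.card_prod, card_fin_fun_two_torsion, pow_add]
  simp

lemma map_doubling_le {α β : ℕ} (C : AddSubgroup (Amb α β)) :
    C.map (doubling α β) ≤
      (AddMonoidHom.fst (Fin α → Z2) (Fin β → Z4)).ker ⊓ ((doubling α β).ker ⊓ C) := by
  rintro _ ⟨x, hx, rfl⟩
  rw [doubling_apply]
  refine ⟨fst_add_self x, ?_, C.add_mem hx hx⟩
  change doubling α β (x + x) = 0
  rw [doubling_apply, add_self_add_add_self]

lemma card_map_doubling_le {α β : ℕ} (C : AddSubgroup (Amb α β)) :
    Nat.card (C.map (doubling α β)) ≤ 2 ^ β := by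
  let g : C.map (doubling α β) → Fin β → {y : Z4 // y + y = 0} :=
    fun x j => ⟨x.1.2 j, snd_add_self_of_mem_ker_doubling (map_doubling_le C x.2).2.1 j⟩
  have hg : Function.Injective g := fun x y hxy => by
    have h₁ : x.1.1 = 0 := (map_doubling_le C x.2).1
    have h₂ : y.1.1 = 0 := (map_doubling_le C y.2).1
    exact Subtype.ext <| Prod.ext (h₁.trans h₂.symm) <| funext fun j =>
      congrArg Subtype.val (congrFun hxy j)
  exact (Nat.card_le_card_of_injective g hg).trans_eq (card_fin_fun_two_torsion β)

lemma card_amb (α β : ℕ) : Nat.card (Amb α β) = 2 ^ (α + 2 * β) := by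
  rw [Nat.card_prod, pow_add, pow_mul]
  simp

namespace isOfType

variable {α β γ δ : ℕ} {C : AddSubgroup (Amb α β)}

lemma card_ker_doubling_inf (h : isOfType C γ δ) :
    Nat.card ↥((doubling α β).ker ⊓ C) = 2 ^ (γ + δ) := by
  rw [← h.2]
  refine Nat.card_congr (Equiv.subtypeEquivRight fun x => ?_)
  rw [AddSubgroup.mem_inf, AddMonoidHom.mem_ker, doubling_apply, and_comm]

lemma card_map_doubling (h : isOfType C γ δ) :
    Nat.card (C.map (doubling α β)) = 2 ^ δ := by
  have hC := card_map_mul_card_inf_ker (doubling α β) C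
  rw [h.card_ker_doubling_inf, h.1] at hC
  refine Nat.eq_of_mul_eq_mul_right (Nat.two_pow_pos (γ + δ)) (hC.trans ?_)
  rw [← pow_add]
  congr 1
  ring

end isOfType

lemma isOfTypeK.kappa_le {α β γ δ κ : ℕ} {C : AddSubgroup (Amb α β)}
    (h : isOfTypeK C γ δ κ) : κ ≤ γ := by
  let p := AddMonoidHom.fst (Fin α → Z2) (Fin β → Z4)
  have hT := card_map_mul_card_inf_ker p ((doubling α β).ker ⊓ C)
  have himage : Nat.card (((doubling α β).ker ⊓ C).map p) = 2 ^ κ := by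
    rw [← h.2]
    refine Nat.card_congr (Equiv.setCongr (congrArg (Prod.fst '' ·) (Set.ext fun x => ?_)))
    rw [SetLike.mem_coe, AddSubgroup.mem_inf, AddMonoidHom.mem_ker, doubling_apply, and_comm]
    rfl
  have hle : 2 ^ δ ≤ Nat.card ↥(p.ker ⊓ ((doubling α β).ker ⊓ C)) :=
    h.1.card_map_doubling ▸ AddSubgroup.card_le_of_le (map_doubling_le C)
  rw [himage, h.1.card_ker_doubling_inf] at hT
  have := (Nat.mul_le_mul_left (2 ^ κ) hle).trans_eq hT
  rw [← pow_add, Nat.pow_le_pow_iff_right one_lt_two] at this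
  omega

section TypeMonotonicity

variable {α β γ δ γ' δ' : ℕ} {C C' : AddSubgroup (Amb α β)}

lemma isOfType.delta_le (h : isOfType C γ δ) (h' : isOfType C' γ' δ') (hC : C ≤ C') :
    δ ≤ δ' := by
  rw [← Nat.pow_le_pow_iff_right one_lt_two, ← h.card_map_doubling, ← h'.card_map_doubling]
  exact AddSubgroup.card_le_of_le (AddSubgroup.map_mono hC)

lemma isOfType.gamma_add_delta_le (h : isOfType C γ δ) (h' : isOfType C' γ' δ')
    (hC : C ≤ C') : γ + δ ≤ γ' + δ' := by
  rw [← Nat.pow_le_pow_iff_right one_lt_two, ← h.card_ker_doubling_inf,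
    ← h'.card_ker_doubling_inf]
  exact AddSubgroup.card_le_of_le (inf_le_inf_left _ hC)

end TypeMonotonicity

section SupBounds

variable {α β γ₁ δ₁ γ₂ δ₂ γ δ : ℕ} {C₁ C₂ : AddSubgroup (Amb α β)}

lemma card_sup_mul_card_inf_of_isOfType (h₁ : isOfType C₁ γ₁ δ₁) (h₂ : isOfType C₂ γ₂ δ₂)
    (h : isOfType (C₁ ⊔ C₂) γ δ) :
    2 ^ (γ + 2 * δ) * Nat.card ↥(C₁ ⊓ C₂) = 2 ^ (γ₁ + γ₂ + 2 * (δ₁ + δ₂)) := by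
  rw [← h.1, card_sup_mul_card_inf, h₁.1, h₂.1, ← pow_add]
  congr 1
  ring

lemma card_map_doubling_sup_mul (h₁ : isOfType C₁ γ₁ δ₁) (h₂ : isOfType C₂ γ₂ δ₂)
    (h : isOfType (C₁ ⊔ C₂) γ δ) :
    2 ^ δ * Nat.card ↥(C₁.map (doubling α β) ⊓ C₂.map (doubling α β)) = 2 ^ (δ₁ + δ₂) := by
  rw [← h.card_map_doubling, AddSubgroup.map_sup, card_sup_mul_card_inf,
    h₁.card_map_doubling, h₂.card_map_doubling, pow_add]

lemma delta_sup_le (h₁ : isOfType C₁ γ₁ δ₁) (h₂ : isOfType C₂ γ₂ δ₂)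
    (h : isOfType (C₁ ⊔ C₂) γ δ) : δ ≤ δ₁ + δ₂ := by
  rw [← Nat.pow_le_pow_iff_right one_lt_two, ← card_map_doubling_sup_mul h₁ h₂ h]
  exact Nat.le_mul_of_pos_right _ Nat.card_pos

lemma gamma_add_two_delta_sup_le (h₁ : isOfType C₁ γ₁ δ₁) (h₂ : isOfType C₂ γ₂ δ₂)
    (h : isOfType (C₁ ⊔ C₂) γ δ) : γ + 2 * δ ≤ γ₁ + γ₂ + 2 * (δ₁ + δ₂) := by
  rw [← Nat.pow_le_pow_iff_right one_lt_two, ← card_sup_mul_card_inf_of_isOfType h₁ h₂ h]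
  exact Nat.le_mul_of_pos_right _ Nat.card_pos

lemma isOfType.delta_le_length {C : AddSubgroup (Amb α β)} (h : isOfType C γ δ) : δ ≤ β := by
  rw [← Nat.pow_le_pow_iff_right one_lt_two, ← h.card_map_doubling]
  exact card_map_doubling_le C

lemma gamma_add_two_delta_sup_le_add_length (h₁ : isOfType C₁ γ₁ δ₁)
    (h₂ : isOfType C₂ γ₂ δ₂) (h : isOfType (C₁ ⊔ C₂) γ δ) :
    γ + 2 * δ ≤ γ₁ + γ₂ + δ₁ + δ₂ + β := by
  have hle : C₁.map (doubling α β) ⊓ C₂.map (doubling α β) ≤ C₁ ⊓ C₂ :=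
    inf_le_inf (fun _ hx => (map_doubling_le C₁ hx).2.2)
      (fun _ hx => (map_doubling_le C₂ hx).2.2)
  have hdouble : 2 ^ (δ₁ + δ₂) ≤ 2 ^ β * Nat.card ↥(C₁ ⊓ C₂) := by
    rw [← card_map_doubling_sup_mul h₁ h₂ h]
    exact Nat.mul_le_mul (Nat.pow_le_pow_right two_pos h.delta_le_length)
      (AddSubgroup.card_le_of_le hle)
  have := Nat.mul_le_mul_left (2 ^ (γ + 2 * δ)) hdouble
  rw [mul_left_comm, card_sup_mul_card_inf_of_isOfType h₁ h₂ h, ← pow_add, ← pow_add,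
    Nat.pow_le_pow_iff_right one_lt_two] at this
  omega

end SupBounds

/-- bounds on `γ + 2δ` for the type of the span of two additive codes;
equivalently, bounds on the cardinality of the span. -/
theorem stmt3 {α β γ₁ δ₁ κ₁ γ₂ δ₂ κ₂ γ δ κ : ℕ} (C₁ C₂ : AddSubgroup (Amb α β))
    (h₁ : isOfTypeK C₁ γ₁ δ₁ κ₁) (h₂ : isOfTypeK C₂ γ₂ δ₂ κ₂)
    (h : isOfTypeK (C₁ ⊔ C₂) γ δ κ) :
    (max (κ₁ + δ₁) (κ₂ + δ₂) + max δ₁ δ₂ ≤ γ + 2 * δ ∧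
      γ + 2 * δ ≤ min (min (γ₁ + γ₂ + 2 * (δ₁ + δ₂)) (γ₁ + γ₂ + δ₁ + δ₂ + β))
        (min (δ₁ + δ₂ + α + β) (α + 2 * β))) ∧
    (2 ^ (max (κ₁ + δ₁) (κ₂ + δ₂) + max δ₁ δ₂) ≤ Nat.card ↥(C₁ ⊔ C₂) ∧
      Nat.card ↥(C₁ ⊔ C₂) ≤
        2 ^ min (min (γ₁ + γ₂ + 2 * (δ₁ + δ₂)) (γ₁ + γ₂ + δ₁ + δ₂ + β))
          (min (δ₁ + δ₂ + α + β) (α + 2 * β))) := by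
  have hmain : max (κ₁ + δ₁) (κ₂ + δ₂) + max δ₁ δ₂ ≤ γ + 2 * δ ∧
      γ + 2 * δ ≤ min (min (γ₁ + γ₂ + 2 * (δ₁ + δ₂)) (γ₁ + γ₂ + δ₁ + δ₂ + β))
        (min (δ₁ + δ₂ + α + β) (α + 2 * β)) := by
    have hκ₁ := h₁.kappa_le
    have hκ₂ := h₂.kappa_le
    have hδ₁ := h₁.1.delta_le h.1 le_sup_left
    have hδ₂ := h₂.1.delta_le h.1 le_sup_right
    have hγ₁ := h₁.1.gamma_add_delta_le h.1 le_sup_left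
    have hγ₂ := h₂.1.gamma_add_delta_le h.1 le_sup_right
    have hsum := gamma_add_two_delta_sup_le h₁.1 h₂.1 h.1
    have hlength := gamma_add_two_delta_sup_le_add_length h₁.1 h₂.1 h.1
    have hδ := delta_sup_le h₁.1 h₂.1 h.1
    have htorsion : γ + δ ≤ α + β := by
      rw [← Nat.pow_le_pow_iff_right one_lt_two, ← h.1.card_ker_doubling_inf]
      exact card_le_of_le_ker_doubling inf_le_left
    have hamb : γ + 2 * δ ≤ α + 2 * β := by
      rw [← Nat.pow_le_pow_iff_right one_lt_two, ← h.1.1, ← card_amb]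
      exact AddSubgroup.card_le_card_addGroup _
    omega
  refine ⟨hmain, ?_⟩
  rw [h.1.1]
  exact ⟨Nat.pow_le_pow_right two_pos hmain.1, Nat.pow_le_pow_right two_pos hmain.2⟩
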